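/- Let g be an (s+1)-step nilpotent Lie algebra with abelian complex structure J whose center has complex dimension one (dim_C c^{1,0} = 1). Let C span t^{s+1,(1,0)} = g_J^{s,(1,0)} and V ∈ t^{s,(1,0)}. Then Λ = C ∧ V satisfies ∂̄Λ = 0 and [Λ,Λ] = 0, i.e., Λ is an invariant holomorphic Poisson structure. -/

import Mathlib

open scoped TensorProduct

noncomputable section

variable (g : Type*) [LieRing g] [LieAlgebra ℝ g]

/-- The canonical inclusion of `g` in its complexification `ℂ ⊗[ℝ] g`. -/
def cx (X : g) : ℂ ⊗[ℝ] g := (1 : ℂ) ⊗ₜ[ℝ] X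

/-- The `(1,0)`-vector `X - i J X` associated to `X ∈ g`. -/
def pOne (J : g →ₗ[ℝ] g) (X : g) : ℂ ⊗[ℝ] g := cx g X - Complex.I • cx g (J X)

/-- The `(0,1)`-vector `X + i J X` associated to `X ∈ g`. -/
def pBar (J : g →ₗ[ℝ] g) (X : g) : ℂ ⊗[ℝ] g := cx g X + Complex.I • cx g (J X)

/-- The `k`-th term `g^k` of the descending central series:
`g^0 = g`, `g^{k+1} = [g^k, g]`. -/
def dcs (k : ℕ) : Submodule ℝ g := (LieModule.lowerCentralSeries ℝ g g k).toSubmodule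

/-- `g_J^k = g^k + J g^k`. -/
def gJ (J : g →ₗ[ℝ] g) (k : ℕ) : Submodule ℝ g := dcs g k ⊔ (dcs g k).map J

/-- `g^{1,0}`, the `+i` eigenspace of `J` in `g_ℂ`. -/
def gOneZero (J : g →ₗ[ℝ] g) : Submodule ℂ (ℂ ⊗[ℝ] g) :=
  Submodule.span ℂ {v | ∃ X : g, v = pOne g J X}

/-- `g^{0,1}`, the `-i` eigenspace of `J` in `g_ℂ`. -/
def gZeroOne (J : g →ₗ[ℝ] g) : Submodule ℂ (ℂ ⊗[ℝ] g) :=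
  Submodule.span ℂ {v | ∃ X : g, v = pBar g J X}

/-- `g_J^{k,(1,0)}`, the `(1,0)`-part of the complexification of `g_J^k`. -/
def gJOneZero (J : g →ₗ[ℝ] g) (k : ℕ) : Submodule ℂ (ℂ ⊗[ℝ] g) :=
  Submodule.span ℂ {v | ∃ X ∈ gJ g J k, v = pOne g J X}

/-- `g_J^{k,(0,1)}`, the `(0,1)`-part of the complexification of `g_J^k`. -/
def gJZeroOne (J : g →ₗ[ℝ] g) (k : ℕ) : Submodule ℂ (ℂ ⊗[ℝ] g) :=
  Submodule.span ℂ {v | ∃ X ∈ gJ g J k, v = pBar g J X}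

/-- The complexification `S_ℂ ⊆ g_ℂ` of a real subspace `S ⊆ g`. -/
def cxSpan (S : Submodule ℝ g) : Submodule ℂ (ℂ ⊗[ℝ] g) :=
  Submodule.span ℂ {v | ∃ X ∈ S, v = cx g X}

/-- The projection `g_ℂ → g^{1,0}`, `v ↦ (v - i J v)/2`. -/
def projOneZero (J : g →ₗ[ℝ] g) : (ℂ ⊗[ℝ] g) →ₗ[ℂ] (ℂ ⊗[ℝ] g) :=
  (1 / 2 : ℂ) • (LinearMap.id - Complex.I • LinearMap.baseChange ℂ J)

/-- `c^{1,0}`, the `(1,0)`-part of the complexified center of `g`. -/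
def cOneZero (J : g →ₗ[ℝ] g) : Submodule ℂ (ℂ ⊗[ℝ] g) :=
  Submodule.span ℂ {v | ∃ X ∈ LieAlgebra.center ℝ g, v = pOne g J X}

theorem aux_swap {g : Type*} [LieRing g] [LieAlgebra ℝ g]
    (J : g →ₗ[ℝ] g) (hJ2 : ∀ X : g, J (J X) = -X)
    (habelian : ∀ A B : g, ⁅J A, J B⁆ = ⁅A, B⁆) (A B : g) : ⁅J A, B⁆ = -⁅A, J B⁆ := by
  have h := habelian A (J B)
  rw [hJ2, lie_neg] at h
  rw [← h, neg_neg]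

theorem aux_dcs {g : Type*} [LieRing g] [LieAlgebra ℝ g] (k : ℕ) (A B : g)
    (hA : A ∈ dcs g k) : ⁅A, B⁆ ∈ dcs g (k + 1) := by
  unfold dcs at *
  rw [← lie_skew]
  refine neg_mem ?_
  rw [LieSubmodule.mem_toSubmodule] at *
  rw [LieModule.lowerCentralSeries_succ]
  exact LieSubmodule.lie_mem_lie (LieSubmodule.mem_top B) hA

theorem aux_gJ {g : Type*} [LieRing g] [LieAlgebra ℝ g]
    (J : g →ₗ[ℝ] g) (hJ2 : ∀ X : g, J (J X) = -X)
    (habelian : ∀ A B : g, ⁅J A, J B⁆ = ⁅A, B⁆) (k : ℕ) (A B : g)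
    (hA : A ∈ gJ g J k) : ⁅A, B⁆ ∈ dcs g (k + 1) := by
  obtain ⟨a, ha, b, hb, rfl⟩ := Submodule.mem_sup.1 hA
  obtain ⟨c, hc, rfl⟩ := hb
  rw [add_lie, aux_swap J hJ2 habelian]
  exact add_mem (aux_dcs k a B ha) (neg_mem (aux_dcs k c _ hc))

theorem aux_gJJ {g : Type*} [LieRing g] [LieAlgebra ℝ g]
    (J : g →ₗ[ℝ] g) (hJ2 : ∀ X : g, J (J X) = -X) (k : ℕ) (A : g)
    (hA : A ∈ gJ g J k) : J A ∈ gJ g J k := by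
  obtain ⟨a, ha, b, hb, rfl⟩ := Submodule.mem_sup.1 hA
  obtain ⟨c, hc, rfl⟩ := hb
  rw [map_add, hJ2]
  exact add_mem (Submodule.mem_sup_right ⟨a, ha, rfl⟩) (Submodule.mem_sup_left (neg_mem hc))

theorem aux_cx {g : Type*} [LieRing g] [LieAlgebra ℝ g] (A B : g) :
    ⁅cx g A, cx g B⁆ = cx g ⁅A, B⁆ := by
  simp [cx]

theorem aux_proj {g : Type*} [LieRing g] [LieAlgebra ℝ g] (J : g →ₗ[ℝ] g) (A : g) :
    projOneZero g J (cx g A) = (1 / 2 : ℂ) • pOne g J A := by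
  simp [cx, projOneZero, pOne]

theorem aux_smul_lie {g : Type*} [LieRing g] [LieAlgebra ℝ g] (c : ℂ) (x y : ℂ ⊗[ℝ] g) :
    ⁅c • x, y⁆ = c • ⁅x, y⁆ := smul_lie c x y

theorem aux_lie_smul {g : Type*} [LieRing g] [LieAlgebra ℝ g] (c : ℂ) (x y : ℂ ⊗[ℝ] g) :
    ⁅x, c • y⁆ = c • ⁅x, y⁆ := lie_smul c x y

theorem aux_lie_add {g : Type*} [LieRing g] [LieAlgebra ℝ g] (x y z : ℂ ⊗[ℝ] g) :
    ⁅x, y + z⁆ = ⁅x, y⁆ + ⁅x, z⁆ := lie_add x y z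

theorem aux_lie_zero {g : Type*} [LieRing g] [LieAlgebra ℝ g] (x : ℂ ⊗[ℝ] g) :
    ⁅x, (0 : ℂ ⊗[ℝ] g)⁆ = 0 := lie_zero x

/-- Brackets of `g_J^{k,(1,0)}` with anything lie in the complexification of `g^{k+1}`. -/
theorem aux_mem {g : Type*} [LieRing g] [LieAlgebra ℝ g]
    (J : g →ₗ[ℝ] g) (hJ2 : ∀ X : g, J (J X) = -X)
    (habelian : ∀ A B : g, ⁅J A, J B⁆ = ⁅A, B⁆) (k : ℕ) (A : g)
    (hA : A ∈ gJ g J k) (z : ℂ ⊗[ℝ] g) : ⁅pOne g J A, z⁆ ∈ cxSpan g (dcs g (k + 1)) := by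
  have key : ∀ B, ⁅pOne g J A, cx g B⁆ ∈ cxSpan g (dcs g (k + 1)) := by
    intro B
    rw [pOne, sub_lie, aux_smul_lie, aux_cx, aux_cx]
    refine sub_mem (Submodule.subset_span ⟨_, aux_gJ J hJ2 habelian k A B hA, rfl⟩)
      (Submodule.smul_mem _ _ (Submodule.subset_span
        ⟨_, aux_gJ J hJ2 habelian k _ B (aux_gJJ J hJ2 k A hA), rfl⟩))
  induction z using TensorProduct.induction_on with
  | zero => rw [aux_lie_zero]; exact zero_mem _
  | add x y hx hy => rw [aux_lie_add]; exact add_mem hx hy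
  | tmul c B =>
    have : c ⊗ₜ[ℝ] B = c • cx g B := by simp [cx, TensorProduct.smul_tmul']
    rw [this, aux_lie_smul]
    exact Submodule.smul_mem _ _ (key B)

theorem aux_projmem {g : Type*} [LieRing g] [LieAlgebra ℝ g]
    (J : g →ₗ[ℝ] g) (k : ℕ) (w : ℂ ⊗[ℝ] g) (hw : w ∈ cxSpan g (dcs g k)) :
    projOneZero g J w ∈ gJOneZero g J k := by
  have : cxSpan g (dcs g k) ≤ (gJOneZero g J k).comap (projOneZero g J) := by
    refine Submodule.span_le.2 ?_
    rintro _ ⟨X, hX, rfl⟩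
    rw [SetLike.mem_coe, Submodule.mem_comap, aux_proj]
    exact Submodule.smul_mem _ _ (Submodule.subset_span ⟨X, Submodule.mem_sup_left hX, rfl⟩)
  exact this hw

open ExteriorAlgebra in
/-- Let `g` be an `(s+1)`-step nilpotent Lie algebra with abelian complex
structure `J` whose center has complex dimension one.  Let `C` span
`t^{s+1,(1,0)} = g_J^{s,(1,0)}` and `V ∈ t^{s,(1,0)} ⊆ g_J^{s-1,(1,0)}`.  Then
`Λ = C ∧ V` is an invariant holomorphic Poisson structure: `∂̄Λ = 0`
(for every `(0,1)`-vector `z`, `[C,z]^{1,0} ∧ V + C ∧ [V,z]^{1,0} = 0`)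
and `[Λ,Λ] = 0` (equivalently `[C,V] = 0` since `g^{1,0}` is abelian). -/
theorem CV_holomorphic_poisson (g : Type*) [LieRing g] [LieAlgebra ℝ g]
    [FiniteDimensional ℝ g]
    (J : g →ₗ[ℝ] g) (hJ2 : ∀ X : g, J (J X) = -X)
    (habelian : ∀ A B : g, ⁅J A, J B⁆ = ⁅A, B⁆)
    (s : ℕ) (hs : 1 ≤ s)
    (hstep : dcs g (s + 1) = ⊥) (hsne : dcs g s ≠ ⊥)
    (hdim : Module.finrank ℂ (cOneZero g J) = 1)
    (Xc : g) (hXc : Xc ∈ gJ g J s)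
    (hCne : pOne g J Xc ≠ 0)
    (hCspan : Submodule.span ℂ {pOne g J Xc} = gJOneZero g J s)
    (Xv : g) (hXv : Xv ∈ gJ g J (s - 1)) :
    (∀ z ∈ gZeroOne g J,
        ι ℂ (projOneZero g J ⁅pOne g J Xc, z⁆) * ι ℂ (pOne g J Xv)
          + ι ℂ (pOne g J Xc) * ι ℂ (projOneZero g J ⁅pOne g J Xv, z⁆) = 0) ∧
      ⁅pOne g J Xc, pOne g J Xv⁆ = 0 := by
  have hC : ∀ z : ℂ ⊗[ℝ] g, ⁅pOne g J Xc, z⁆ = 0 := by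
    intro z
    have h := aux_mem J hJ2 habelian s Xc hXc z
    rw [hstep] at h
    have h0 : cxSpan g (⊥ : Submodule ℝ g) ≤ ⊥ := by
      refine Submodule.span_le.2 ?_
      rintro _ ⟨X, hX, rfl⟩
      rw [Submodule.mem_bot] at hX
      simp [hX, cx]
    exact (Submodule.mem_bot ℂ).1 (h0 h)
  refine ⟨fun z _ => ?_, hC _⟩
  have h := aux_projmem J _ _ (aux_mem J hJ2 habelian (s - 1) Xv hXv z)
  rw [Nat.sub_add_cancel hs, ← hCspan] at h
  obtain ⟨c, hc⟩ := Submodule.mem_span_singleton.1 h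
  rw [hC, ← hc]
  simp

end
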